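/- arXiv:1706.08937 — 4 statements merged into one kernel-verified Lean document; each statement's English description precedes it below -/
import Mathlib

section
/- Under the extended coloring setup, Σ_{i=1}^{n} w(G_i) ≥ C(N, 2) − 6n^{3/2} − 21n. -/
open Finset

/-- The 3-graph `H` contains a copy of the loose path `𝒫` with three edges. -/
def HasLoosePath {V : Type*} [DecidableEq V] (H : Finset (Finset V)) : Prop :=
  ∃ a b c d e f g : V, ([a, b, c, d, e, f, g] : List V).Nodup ∧
    ({a, b, c} : Finset V) ∈ H ∧ ({c, d, e} : Finset V) ∈ H ∧ ({e, f, g} : Finset V) ∈ H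

/-- `C(x, 2) = x (x − 1) / 2` for a real number `x`. -/
noncomputable def realChoose2 (x : ℝ) : ℝ := x * (x - 1) / 2

/-- `H` is quasi-bipartite with respect to the vertex set `W`. -/
def QuasiBipartite {V : Type*} [DecidableEq V] (W : Finset V) (H : Finset (Finset V)) : Prop :=
  ∃ (s t : ℕ) (x y : Fin s → V) (z : Fin t → V),
    Function.Injective x ∧ Function.Injective y ∧ Function.Injective z ∧
    (∀ i j, x i ≠ y j) ∧ (∀ i j, x i ≠ z j) ∧ (∀ i j, y i ≠ z j) ∧
    (Finset.image x Finset.univ ∪ Finset.image y Finset.univ ∪ Finset.image z Finset.univ = W) ∧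
    (∀ e ∈ H, ∃ i j, e = ({x i, y i, z j} : Finset V))

/-- `H` is a family of vertex-disjoint stars with centers in `C` and other vertices in `S`. -/
def DisjointStars {V : Type*} [DecidableEq V] (H : Finset (Finset V)) (C S : Finset V) : Prop :=
  ∃ c : Finset V → V,
    (∀ e ∈ H, c e ∈ e ∧ c e ∈ C ∧ ∀ x ∈ e, x ≠ c e → x ∈ S) ∧
    (∀ e ∈ H, ∀ f ∈ H, c e ≠ c f → Disjoint e f)

/-- The 3-graph formed by the triples of color `i`. -/
def colorClass {n N : ℕ} (χ : Finset (Fin N) → Fin n) (i : Fin n) :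
    Finset (Finset (Fin N)) :=
  Finset.univ.filter (fun e => e.card = 3 ∧ χ e = i)

/-- The color `i` is rich: `|H_i| ≥ C(n + 6√n − 1, 2) + C(N − n − 6√n, 2)`. -/
noncomputable def Rich (n N : ℕ) (χ : Finset (Fin N) → Fin n) (i : Fin n) : Prop :=
  realChoose2 ((n : ℝ) + 6 * Real.sqrt n - 1) + realChoose2 ((N : ℝ) - n - 6 * Real.sqrt n)
    ≤ ((colorClass χ i).card : ℝ)

/-- `H_R^i = {h ∈ H_i : h ∩ V_R^i ≠ ∅}`. -/
def HRpart {n N : ℕ} (χ : Finset (Fin N) → Fin n) (VR : Fin n → Finset (Fin N)) (i : Fin n) :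
    Finset (Finset (Fin N)) :=
  (colorClass χ i).filter (fun e => (e ∩ VR i).Nonempty)

/-- `H_T^i = H_i[V_T^i]`. -/
def HTpart {n N : ℕ} (χ : Finset (Fin N) → Fin n) (VT : Fin n → Finset (Fin N)) (i : Fin n) :
    Finset (Finset (Fin N)) :=
  (colorClass χ i).filter (fun e => e ⊆ VT i)

/-- `H_S^i = {h ∈ H_i[V ∖ V_R^i] : h ∩ V_S^i ≠ ∅}`. -/
def HSpart {n N : ℕ} (χ : Finset (Fin N) → Fin n) (VR VS : Fin n → Finset (Fin N)) (i : Fin n) :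
    Finset (Finset (Fin N)) :=
  (colorClass χ i).filter (fun e => e ∩ VR i = ∅ ∧ (e ∩ VS i).Nonempty)

/-- `Ĥ_i = H_i ∖ H_R^i`. -/
def Hhat {n N : ℕ} (χ : Finset (Fin N) → Fin n) (VR : Fin n → Finset (Fin N)) (i : Fin n) :
    Finset (Finset (Fin N)) :=
  (colorClass χ i).filter (fun e => e ∩ VR i = ∅)

/-- The set of blank triples: triples belonging to `H_R^i` for their own color `i`. -/
def BlankSet {n N : ℕ} (χ : Finset (Fin N) → Fin n) (VR : Fin n → Finset (Fin N)) :
    Finset (Finset (Fin N)) :=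
  Finset.univ.filter (fun e => e.card = 3 ∧ (e ∩ VR (χ e)).Nonempty)

/-- The edge finset of a simple graph on a finite vertex type. -/
noncomputable def edgeF {V : Type*} [Fintype V] (G : SimpleGraph V) : Finset (Sym2 V) :=
  (Set.toFinite G.edgeSet).toFinset

/-- The private edges of `G i`: edges of `G i` lying in no `G j` with `j ≠ i`. -/
noncomputable def privE {n N : ℕ} (G : Fin n → SimpleGraph (Fin N)) (i : Fin n) :
    Finset (Sym2 (Fin N)) :=
  (edgeF (G i)).filter (fun p => ∀ j, j ≠ i → p ∉ edgeF (G j))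

/-- The public edges of `G i`: edges of `G i` lying in some `G j` with `j ≠ i`. -/
noncomputable def pubE {n N : ℕ} (G : Fin n → SimpleGraph (Fin N)) (i : Fin n) :
    Finset (Sym2 (Fin N)) :=
  (edgeF (G i)).filter (fun p => ∃ j, j ≠ i ∧ p ∈ edgeF (G j))

/-- The weight `w(G_i) = e_i + e'_i / 2`. -/
noncomputable def wG {n N : ℕ} (G : Fin n → SimpleGraph (Fin N)) (i : Fin n) : ℝ :=
  ((privE G i).card : ℝ) + ((pubE G i).card : ℝ) / 2

theorem weight_aux {n N : ℕ} (G : Fin n → SimpleGraph (Fin N)) :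
    (((univ : Finset (Sym2 (Fin N))).filter (fun p => ∃ i, p ∈ edgeF (G i))).card : ℝ)
      ≤ ∑ i : Fin n, wG G i := by
  classical
  have h1 : ∀ i, wG G i = ∑ p : Sym2 (Fin N),
      ((if p ∈ privE G i then (1 : ℝ) else 0) + (if p ∈ pubE G i then (1 / 2 : ℝ) else 0)) := by
    intro i
    rw [Finset.sum_add_distrib, ← Finset.sum_filter, ← Finset.sum_filter]
    simp [wG, div_eq_mul_inv]
  simp_rw [h1]
  rw [Finset.sum_comm, Finset.card_eq_sum_ones, Nat.cast_sum, Finset.sum_filter]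
  apply Finset.sum_le_sum
  intro p _
  have hnn : ∀ i ∈ (univ : Finset (Fin n)), (0 : ℝ) ≤
      ((if p ∈ privE G i then (1 : ℝ) else 0) + (if p ∈ pubE G i then (1 / 2 : ℝ) else 0)) := by
    intro i _
    split_ifs <;> norm_num
  split_ifs with h
  · obtain ⟨i, hi⟩ := h
    by_cases hp : ∃ j, j ≠ i ∧ p ∈ edgeF (G j)
    · obtain ⟨j, hji, hj⟩ := hp
      have hs := Finset.sum_le_sum_of_subset_of_nonneg (Finset.subset_univ ({i, j} : Finset (Fin n)))
        (fun k hk _ => hnn k hk)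
      rw [Finset.sum_pair hji.symm] at hs
      refine le_trans ?_ hs
      have a1 : p ∈ pubE G i := by
        simp only [pubE, Finset.mem_filter]; exact ⟨hi, j, hji, hj⟩
      have a2 : p ∈ pubE G j := by
        simp only [pubE, Finset.mem_filter]; exact ⟨hj, i, hji.symm, hi⟩
      rw [if_pos a1, if_pos a2]
      split_ifs <;> norm_num
    · have a1 : p ∈ privE G i := by
        simp only [privE, Finset.mem_filter]
        exact ⟨hi, fun j hj hp' => hp ⟨j, hj, hp'⟩⟩
      refine le_trans ?_ (Finset.single_le_sum hnn (Finset.mem_univ i))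
      rw [if_pos a1]
      split_ifs <;> norm_num
  · exact Finset.sum_nonneg hnn

theorem blank_card {n N : ℕ} (χ : Finset (Fin N) → Fin n) (VR : Fin n → Finset (Fin N))
    (hR : ∀ i, (HRpart χ VR i).card ≤ 6 * (VR i).card) :
    (BlankSet χ VR).card ≤ n * (6 * N) := by
  classical
  have hsub : BlankSet χ VR ⊆ univ.biUnion (fun i => HRpart χ VR i) := by
    intro e he
    simp only [BlankSet, Finset.mem_filter, Finset.mem_univ, true_and] at he
    simp only [Finset.mem_biUnion, Finset.mem_univ, true_and, HRpart, colorClass,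
      Finset.mem_filter]
    exact ⟨χ e, ⟨he.1, rfl⟩, he.2⟩
  refine (Finset.card_le_card hsub).trans ?_
  have := Finset.card_biUnion_le_card_mul (univ : Finset (Fin n)) (fun i => HRpart χ VR i) (6 * N)
    (fun i _ => (hR i).trans (by
      have := Finset.card_le_univ (VR i)
      simp at this
      omega))
  simpa using this

/-- triples containing a pair -/
theorem triples_card {N : ℕ} (u v : Fin N) (huv : u ≠ v) :
    N - 2 ≤ ((univ : Finset (Finset (Fin N))).filter
      (fun e => e.card = 3 ∧ u ∈ e ∧ v ∈ e)).card := by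
  classical
  have h : (univ \ {u, v} : Finset (Fin N)).card = N - 2 := by
    rw [Finset.card_sdiff_of_subset (Finset.subset_univ _), Finset.card_pair huv]; simp
  rw [← h]
  apply Finset.card_le_card_of_injOn (fun w => ({u, v, w} : Finset (Fin N)))
  · intro w hw
    simp at hw
    simp only [Finset.coe_filter, Finset.mem_univ, true_and, Set.mem_ofPred_eq]
    refine ⟨Finset.card_eq_three.2 ⟨u, v, w, huv, ?_, ?_, rfl⟩, by simp, by simp⟩
    · exact fun h => hw.1 h.symm
    · exact fun h => hw.2 h.symm
  · intro w hw w' hw' heq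
    simp at hw hw'
    have : w ∈ ({u, v, w'} : Finset (Fin N)) := by
      have h2 : w ∈ ({u, v, w} : Finset (Fin N)) := by simp
      have h3 : ({u, v, w} : Finset (Fin N)) = {u, v, w'} := heq
      rw [h3] at h2
      exact h2
    simp at this
    tauto

theorem bad_pair {n N : ℕ} (χ : Finset (Fin N) → Fin n) (VR : Fin n → Finset (Fin N))
    (u v : Fin N) (huv : u ≠ v)
    (h : ∀ i, ((Hhat χ VR i).filter (fun e => u ∈ e ∧ v ∈ e)).card ≤ 1) :
    N - 2 ≤ ((BlankSet χ VR).filter (fun e => u ∈ e ∧ v ∈ e)).card + n := by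
  classical
  refine (triples_card u v huv).trans ?_
  have hsub : (univ : Finset (Finset (Fin N))).filter (fun e => e.card = 3 ∧ u ∈ e ∧ v ∈ e) ⊆
      ((BlankSet χ VR).filter (fun e => u ∈ e ∧ v ∈ e)) ∪
        univ.biUnion (fun i => (Hhat χ VR i).filter (fun e => u ∈ e ∧ v ∈ e)) := by
    intro e he
    simp only [Finset.mem_filter, Finset.mem_univ, true_and] at he
    simp only [Finset.mem_union, Finset.mem_biUnion, Finset.mem_univ, true_and, Hhat, BlankSet,
      colorClass, Finset.mem_filter]
    by_cases hb : (e ∩ VR (χ e)).Nonempty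
    · exact Or.inl ⟨⟨he.1, hb⟩, he.2⟩
    · exact Or.inr ⟨χ e, ⟨⟨he.1, rfl⟩, Finset.not_nonempty_iff_eq_empty.1 hb⟩, he.2⟩
  refine (Finset.card_le_card hsub).trans ((Finset.card_union_le _ _).trans ?_)
  have := Finset.card_biUnion_le_card_mul (univ : Finset (Fin n))
    (fun i => (Hhat χ VR i).filter (fun e => u ∈ e ∧ v ∈ e)) 1 (fun i _ => h i)
  simp at this
  omega

theorem double_count {N : ℕ} (B : Finset (Finset (Fin N))) (hB : ∀ e ∈ B, e.card = 3)
    (D : Finset (Sym2 (Fin N))) (hD : ∀ p ∈ D, ¬ p.IsDiag) :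
    ∑ p ∈ D, (B.filter (fun e => ∀ x ∈ p, x ∈ e)).card ≤ B.card * 3 := by
  classical
  have := Finset.sum_card_bipartiteAbove_eq_sum_card_bipartiteBelow
    (s := D) (t := B) (fun p e => ∀ x ∈ p, x ∈ e)
  simp only [Finset.bipartiteAbove, Finset.bipartiteBelow] at this
  rw [this, ← smul_eq_mul]
  apply Finset.sum_le_card_nsmul
  intro e he
  have h3 : (e.offDiag.image Sym2.mk.uncurry).card = 3 := by
    have := Sym2.card_image_offDiag e
    rw [hB e he] at this
    exact this
  rw [← h3]
  apply Finset.card_le_card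
  intro p hp
  rw [Finset.mem_filter] at hp
  obtain ⟨hp, hx⟩ := hp
  have hd := hD p hp
  induction p with
  | _ a b =>
    simp only [Sym2.mk_isDiag_iff] at hd
    simp only [Finset.mem_image, Finset.mem_offDiag]
    exact ⟨(a, b), ⟨hx a (by simp), hx b (by simp), hd⟩, rfl⟩

theorem sum_weight_lower (n N : ℕ) (hn : 41 ≤ n) (γ : ℝ)
    (hγ : γ = ((N : ℝ) - 7 * Real.sqrt n) / n) (hγ1 : 1.9 < γ) (hγ2 : γ < 2)
    (χ : Finset (Fin N) → Fin n)
    (hfree : ∀ i : Fin n, ¬ HasLoosePath (colorClass χ i))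
    (VR VT VS : Fin n → Finset (Fin N))
    (hpart : ∀ i, Disjoint (VR i) (VT i) ∧ Disjoint (VR i) (VS i) ∧ Disjoint (VT i) (VS i) ∧
      VR i ∪ VT i ∪ VS i = Finset.univ)
    (hR : ∀ i, (HRpart χ VR i).card ≤ 6 * (VR i).card)
    (hTqb : ∀ i, QuasiBipartite (VT i) (HTpart χ VT i))
    (hTcard : ∀ i, ((HTpart χ VT i).card : ℝ) ≤ ((VT i).card : ℝ) ^ 2 / 8)
    (hSstars : ∀ i, DisjointStars (HSpart χ VR VS i) (VT i) (VS i))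
    (G : Fin n → SimpleGraph (Fin N))
    (hG : ∀ i u v, (G i).Adj u v ↔ u ≠ v ∧
      2 ≤ ((Hhat χ VR i).filter (fun e => u ∈ e ∧ v ∈ e)).card ∧
      ((((BlankSet χ VR).filter (fun e => u ∈ e ∧ v ∈ e)).card : ℝ) < 6 * Real.sqrt n)) :
    realChoose2 (N : ℝ) - 6 * ((n : ℝ) * Real.sqrt n) - 21 * (n : ℝ)
      ≤ ∑ i : Fin n, wG G i := by
  classical
  refine le_trans ?_ (weight_aux G)
  have hs41 : (6 : ℝ) ≤ Real.sqrt n := by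
    apply Real.le_sqrt_of_sq_le
    have : (41 : ℝ) ≤ n := by exact_mod_cast hn
    linarith
  have hn0 : (41 : ℝ) ≤ n := by exact_mod_cast hn
  have hss : Real.sqrt n * Real.sqrt n = n := Real.mul_self_sqrt (by positivity)
  have hγn : γ * n = N - 7 * Real.sqrt n := by
    rw [hγ]; field_simp
  have hN1 : 1.9 * (n : ℝ) + 7 * Real.sqrt n ≤ N := by nlinarith
  have hN2 : (N : ℝ) ≤ 2 * n + 7 * Real.sqrt n := by nlinarith
  set A := (univ : Finset (Sym2 (Fin N))).filter (fun p => ∃ i, p ∈ edgeF (G i)) with hA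
  set P := (univ : Finset (Sym2 (Fin N))).filter (fun p => ¬ p.IsDiag) with hP
  have hPc : P.card = N.choose 2 := by
    have := Sym2.card_subtype_not_diag (α := Fin N)
    rw [Fintype.card_subtype] at this
    simpa using this
  set D := P \ A with hDdef
  have hcard : P.card ≤ A.card + D.card := by
    have : P.card - A.card ≤ D.card := by
      rw [hDdef]
      convert Finset.le_card_sdiff A P
    omega
  have hDbig : ∀ p ∈ D, 6 * Real.sqrt n ≤
      (((BlankSet χ VR).filter (fun e => ∀ x ∈ p, x ∈ e)).card : ℝ) := by
    intro p hp
    simp only [hDdef, hP, hA, Finset.mem_sdiff, Finset.mem_filter, Finset.mem_univ, true_and] at hp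
    induction p with
    | _ u v =>
      obtain ⟨hd, hno⟩ := hp
      have huv : u ≠ v := by simpa using hd
      have heq : (BlankSet χ VR).filter (fun e => ∀ x ∈ s(u, v), x ∈ e) =
          (BlankSet χ VR).filter (fun e => u ∈ e ∧ v ∈ e) := by
        apply Finset.filter_congr
        intro e _
        simp
      rw [heq]
      by_contra hlt
      push Not at hlt
      have hall : ∀ i, ((Hhat χ VR i).filter (fun e => u ∈ e ∧ v ∈ e)).card ≤ 1 := by
        intro i
        by_contra h2
        apply hno
        refine ⟨i, ?_⟩
        simp only [edgeF, Set.Finite.mem_toFinset, SimpleGraph.mem_edgeSet]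
        exact (hG i u v).2 ⟨huv, by omega, hlt⟩
      have hb := bad_pair χ VR u v huv hall
      have hb' : N ≤ ((BlankSet χ VR).filter (fun e => u ∈ e ∧ v ∈ e)).card + n + 2 := by omega
      have hb2 : (N : ℝ) ≤ (((BlankSet χ VR).filter (fun e => u ∈ e ∧ v ∈ e)).card : ℝ) + n + 2 := by
        exact_mod_cast hb'
      linarith
  have hdc := double_count (BlankSet χ VR)
    (by intro e he; simp only [BlankSet, Finset.mem_filter] at he; exact he.2.1) D
    (by intro p hp; simp only [hDdef, hP, Finset.mem_sdiff, Finset.mem_filter] at hp; exact hp.1.2)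
  have hbc := blank_card χ VR hR
  have hsum := Finset.card_nsmul_le_sum D _ _ hDbig
  rw [nsmul_eq_mul] at hsum
  have htot : ∑ p ∈ D, (((BlankSet χ VR).filter (fun e => ∀ x ∈ p, x ∈ e)).card : ℝ)
      ≤ n * (6 * N) * 3 := by
    exact_mod_cast hdc.trans (Nat.mul_le_mul_right 3 hbc)
  have hDs : (D.card : ℝ) ≤ 3 * Real.sqrt n * N := by
    have h1 : (D.card : ℝ) * (6 * Real.sqrt n) ≤ (3 * Real.sqrt n * N) * (6 * Real.sqrt n) := by
      calc _ ≤ (n : ℝ) * (6 * N) * 3 := hsum.trans htot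
        _ = (Real.sqrt n * Real.sqrt n) * (6 * N) * 3 := by rw [hss]
        _ = _ := by ring
    exact le_of_mul_le_mul_right h1 (by positivity)
  have hDf : (D.card : ℝ) ≤ 6 * (n * Real.sqrt n) + 21 * n := by
    refine hDs.trans ?_
    calc 3 * Real.sqrt n * N ≤ 3 * Real.sqrt n * (2 * n + 7 * Real.sqrt n) := by gcongr
      _ = 6 * (n * Real.sqrt n) + 21 * (Real.sqrt n * Real.sqrt n) := by ring
      _ = _ := by rw [hss]
  have hPr : (P.card : ℝ) = realChoose2 N := by
    rw [hPc, Nat.cast_choose_two, realChoose2]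
  have hcr : (P.card : ℝ) ≤ A.card + D.card := by exact_mod_cast hcard
  linarith
end

section
/- Let f(γ) = (γ³ − 3γ² + 6γ − 6)² − 72γ(2−γ)(γ−1)². Then there exists a unique real number λ₀ ∈ (1.9, 2) such that f(λ₀) = 0 and f(γ) > 0 for all γ ∈ (λ₀, 2); moreover 1.9746 < λ₀ < 1.9747. -/
/-- The polynomial `f(γ) = (γ³ − 3γ² + 6γ − 6)² − 72γ(2−γ)(γ−1)²`. -/
def fpoly (γ : ℝ) : ℝ :=
  (γ ^ 3 - 3 * γ ^ 2 + 6 * γ - 6) ^ 2 - 72 * γ * (2 - γ) * (γ - 1) ^ 2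

theorem fpoly_lt {a b : ℝ} (ha : 1.9 ≤ a) (hab : a < b) : fpoly a < fpoly b := by
  obtain ⟨x, rfl⟩ : ∃ x, a = x + 1 := ⟨a - 1, by ring⟩
  obtain ⟨y, rfl⟩ : ∃ y, b = y + 1 := ⟨b - 1, by ring⟩
  have hx : 0.9 ≤ x := by norm_num at ha ⊢; linarith
  have hxy : x < y := by linarith
  have h0 : 0 ≤ x := by norm_num at hx; linarith
  have e : ∀ t : ℝ, fpoly (t + 1) = (t ^ 3 + 3 * t - 2) ^ 2 + 72 * (t ^ 2 * (t ^ 2 - 1)) := by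
    intro t; unfold fpoly; ring
  rw [e, e]
  have h3 : x ^ 3 < y ^ 3 := by gcongr
  have h2 : x ^ 2 < y ^ 2 := by gcongr
  have hx3 : (0.9 : ℝ) ^ 3 ≤ x ^ 3 := by gcongr
  have hx2 : (0.9 : ℝ) ^ 2 ≤ x ^ 2 := by gcongr
  norm_num at hx hx3 hx2
  have hp : (x ^ 3 + 3 * x - 2) ^ 2 < (y ^ 3 + 3 * y - 2) ^ 2 := by
    apply pow_lt_pow_left₀ <;> first | linarith | norm_num
  have hq : x ^ 2 * (x ^ 2 - 1) < y ^ 2 * (y ^ 2 - 1) := by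
    have := mul_pos (sub_pos.2 h2) (show 0 < x ^ 2 + y ^ 2 - 1 by linarith)
    linarith
  linarith

theorem lambda0_exists_unique :
    ∃ lam : ℝ,
      (lam ∈ Set.Ioo (1.9 : ℝ) 2 ∧ fpoly lam = 0 ∧
        (∀ γ ∈ Set.Ioo lam (2 : ℝ), 0 < fpoly γ) ∧
        (1.9746 : ℝ) < lam ∧ lam < (1.9747 : ℝ)) ∧
      ∀ lam' : ℝ,
        (lam' ∈ Set.Ioo (1.9 : ℝ) 2 ∧ fpoly lam' = 0 ∧
          ∀ γ ∈ Set.Ioo lam' (2 : ℝ), 0 < fpoly γ) → lam' = lam := by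
  have hc : ContinuousOn fpoly (Set.Icc 1.9746 1.9747) := by
    unfold fpoly; fun_prop
  have h := intermediate_value_Ioo (by norm_num) hc
  obtain ⟨l, ⟨h1, h2⟩, h0⟩ := h (show (0 : ℝ) ∈ Set.Ioo _ _ by
    constructor <;> (unfold fpoly; norm_num))
  have h19 : (1.9 : ℝ) < l := lt_trans (by norm_num) h1
  refine ⟨l, ⟨⟨h19, lt_trans h2 (by norm_num)⟩, h0, ?_, h1, h2⟩, ?_⟩
  · intro γ hγ
    rw [← h0]
    exact fpoly_lt h19.le hγ.1
  · rintro m ⟨hm, hm0, -⟩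
    rcases lt_trichotomy m l with hlt | heq | hgt
    · have := fpoly_lt hm.1.le hlt
      linarith
    · exact heq
    · have := fpoly_lt h19.le hgt
      linarith
end

section
/- For all real γ with 1.9 < γ < 2, all real β with 0 ≤ β < 1/3, and every integer n ≥ 1, one has [β(36γ−30) − (21γ² − 6γ − 30)]·n^{5/2} + [β(42−6γ) − (150γ − 3γ² − 105)]·n² − [6β + 400 − 42γ]·n^{3/2} − [2γ − 153]·n − 14√n ≤ −19n^{5/2} − 157n² − 316n^{3/2} + 150n − 14√n < 0. -/
theorem arith_ineq_rich (γ β : ℝ) (hγ1 : 1.9 < γ) (hγ2 : γ < 2)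
    (hβ0 : 0 ≤ β) (hβ1 : β < 1 / 3) (n : ℕ) (hn : 1 ≤ n) :
    ((β * (36 * γ - 30) - (21 * γ ^ 2 - 6 * γ - 30)) * ((n : ℝ) ^ 2 * Real.sqrt n)
        + (β * (42 - 6 * γ) - (150 * γ - 3 * γ ^ 2 - 105)) * (n : ℝ) ^ 2
        - (6 * β + 400 - 42 * γ) * ((n : ℝ) * Real.sqrt n)
        - (2 * γ - 153) * (n : ℝ) - 14 * Real.sqrt n
      ≤ -19 * ((n : ℝ) ^ 2 * Real.sqrt n) - 157 * (n : ℝ) ^ 2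
        - 316 * ((n : ℝ) * Real.sqrt n) + 150 * (n : ℝ) - 14 * Real.sqrt n) ∧
    (-19 * ((n : ℝ) ^ 2 * Real.sqrt n) - 157 * (n : ℝ) ^ 2
        - 316 * ((n : ℝ) * Real.sqrt n) + 150 * (n : ℝ) - 14 * Real.sqrt n < 0) := by
  have hn' : (1 : ℝ) ≤ n := by exact_mod_cast hn
  have hs : 0 < Real.sqrt n := Real.sqrt_pos.mpr (by linarith)
  norm_num at hγ1
  set s := Real.sqrt n
  have c1 : β * (36 * γ - 30) - (21 * γ ^ 2 - 6 * γ - 30) ≤ -19 := by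
    have h : β * (36 * γ - 30) ≤ 1 / 3 * (36 * γ - 30) :=
      mul_le_mul_of_nonneg_right hβ1.le (by linarith)
    nlinarith
  have c2 : β * (42 - 6 * γ) - (150 * γ - 3 * γ ^ 2 - 105) ≤ -157 := by
    have h : β * (42 - 6 * γ) ≤ 1 / 3 * (42 - 6 * γ) :=
      mul_le_mul_of_nonneg_right hβ1.le (by linarith)
    nlinarith
  have c3 : 316 ≤ 6 * β + 400 - 42 * γ := by linarith
  have c4 : -150 ≤ 2 * γ - 153 := by linarith
  have p1 : 0 < (n : ℝ) ^ 2 * s := by positivity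
  have p3 : 0 < (n : ℝ) * s := by positivity
  have p2 : (n : ℝ) ≤ (n : ℝ) ^ 2 := by nlinarith
  constructor
  · have h1 := mul_le_mul_of_nonneg_right c1 p1.le
    have h2 := mul_le_mul_of_nonneg_right c2 (sq_nonneg (n : ℝ))
    have h3 := mul_le_mul_of_nonneg_right c3 p3.le
    have h4 := mul_le_mul_of_nonneg_right c4 (show (0 : ℝ) ≤ n by linarith)
    linarith
  · linarith
end

section
/- Under the extended coloring setup, C(N, 2) − 6n^{3/2} − 21n ≤ nN − |I|²/4, where I is the set of rich colors. -/
open Finset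

namespace Aux

variable {V : Type*} [DecidableEq V]

/-- A family of triples containing a fixed pair, the third vertex lying in `W`. -/
lemma card_le_third (F : Finset (Finset V)) (p W : Finset V) (hp : p.card = 2)
    (h3 : ∀ e ∈ F, e.card = 3) (hpe : ∀ e ∈ F, p ⊆ e) (hW : ∀ e ∈ F, e \ p ⊆ W) :
    F.card ≤ W.card := by
  have hsub : F ⊆ W.image (fun v => insert v p) := by
    intro e he
    have h1 : (e \ p).card = 1 := by
      rw [Finset.card_sdiff_of_subset (hpe e he), h3 e he, hp]
    obtain ⟨v, hv⟩ := Finset.card_eq_one.1 h1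
    refine Finset.mem_image.2 ⟨v, hW e he (by simp [hv]), ?_⟩
    have := Finset.sdiff_union_of_subset (hpe e he)
    rw [hv] at this
    rw [Finset.insert_eq]
    exact this
  exact (Finset.card_le_card hsub).trans Finset.card_image_le

/-- Classification of the pairs of degree at least two in a non-blank color class. -/
lemma classify (H : Finset (Finset V)) (h3 : ∀ e ∈ H, e.card = 3) (R T S : Finset V)
    (hTS : Disjoint T S) (hcov : ∀ v, v ∈ R ∨ v ∈ T ∨ v ∈ S)
    (c : Finset V → V)
    (hc1 : ∀ e ∈ H.filter (fun e => e ∩ R = ∅ ∧ (e ∩ S).Nonempty),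
      c e ∈ e ∧ c e ∈ T ∧ ∀ x ∈ e, x ≠ c e → x ∈ S)
    (hc2 : ∀ e ∈ H.filter (fun e => e ∩ R = ∅ ∧ (e ∩ S).Nonempty),
      ∀ f ∈ H.filter (fun e => e ∩ R = ∅ ∧ (e ∩ S).Nonempty), c e ≠ c f → Disjoint e f)
    (p : Finset V) (hp : p.card = 2)
    (hd : 2 ≤ ((H.filter (fun e => e ∩ R = ∅)).filter (fun e => p ⊆ e)).card) :
    (p ⊆ T ∧ ∀ e ∈ H.filter (fun e => e ∩ R = ∅), p ⊆ e → e ⊆ T) ∨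
    (∃ a v, p = {a, v} ∧ a ∈ T ∧ v ∈ S ∧ ∀ e ∈ H.filter (fun e => e ∩ R = ∅), p ⊆ e →
      e ∈ H.filter (fun e => e ∩ R = ∅ ∧ (e ∩ S).Nonempty) ∧ c e = a) := by
  classical
  have hdis : ∀ x, x ∈ T → x ∈ S → False := fun x hx hy => (Finset.disjoint_left.1 hTS hx hy)
  have key : ∀ e ∈ H.filter (fun e => e ∩ R = ∅), e ⊆ T ∨
      e ∈ H.filter (fun e => e ∩ R = ∅ ∧ (e ∩ S).Nonempty) := by
    intro e he
    obtain ⟨heH, heR⟩ := Finset.mem_filter.1 he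
    by_cases h : (e ∩ S).Nonempty
    · right; exact Finset.mem_filter.2 ⟨heH, heR, h⟩
    · left
      intro x hx
      rcases hcov x with h1 | h1 | h1
      · have : x ∈ e ∩ R := Finset.mem_inter.2 ⟨hx, h1⟩
        rw [heR] at this; simp at this
      · exact h1
      · exact absurd ⟨x, Finset.mem_inter.2 ⟨hx, h1⟩⟩ h
  obtain ⟨u, v, huv, rfl⟩ := Finset.card_eq_two.1 hp
  have hpe : ∀ e : Finset V, ({u, v} : Finset V) ⊆ e ↔ u ∈ e ∧ v ∈ e := by
    intro e; simp [Finset.insert_subset_iff]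
  -- a star edge containing a vertex of `T` has it as center
  have hcT : ∀ e ∈ H.filter (fun e => e ∩ R = ∅ ∧ (e ∩ S).Nonempty), ∀ x ∈ e, x ∈ T →
      c e = x := by
    intro e he x hx hxT
    by_contra hne
    exact hdis x hxT ((hc1 e he).2.2 x hx (fun h => hne h.symm))
  obtain ⟨e, he, f, hf, hef⟩ := Finset.one_lt_card.1 hd
  obtain ⟨he, hpe'⟩ := Finset.mem_filter.1 he
  obtain ⟨hf, hpf'⟩ := Finset.mem_filter.1 hf
  rw [hpe] at hpe' hpf'
  have mem : ∀ e ∈ H.filter (fun e => e ∩ R = ∅), ∀ x ∈ e, x ∈ T ∨ x ∈ S := by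
    intro e he x hx
    rcases key e he with h | h
    · exact Or.inl (h hx)
    · by_cases hx' : x = c e
      · left; rw [hx']; exact (hc1 e h).2.1
      · right; exact (hc1 e h).2.2 x hx hx'
  have star : ∀ a b, a ∈ T → b ∈ S → ∀ e ∈ H.filter (fun e => e ∩ R = ∅), a ∈ e → b ∈ e →
      e ∈ H.filter (fun e => e ∩ R = ∅ ∧ (e ∩ S).Nonempty) ∧ c e = a := by
    intro a b ha hb e he hae hbe
    rcases key e he with h | h
    · exact (hdis b (h hbe) hb).elim
    · exact ⟨h, hcT e h a hae ha⟩
  rcases mem e he u hpe'.1 with hu | hu <;> rcases mem e he v hpe'.2 with hv | hv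
  · left
    refine ⟨by simp [Finset.insert_subset_iff, hu, hv], ?_⟩
    intro g hg hpg
    rw [hpe] at hpg
    rcases key g hg with h | h
    · exact h
    · exact absurd ((hcT g h u hpg.1 hu).symm.trans (hcT g h v hpg.2 hv)) huv
  · right
    refine ⟨u, v, rfl, hu, hv, ?_⟩
    intro g hg hpg
    rw [hpe] at hpg
    exact star u v hu hv g hg hpg.1 hpg.2
  · right
    refine ⟨v, u, Finset.pair_comm u v, hv, hu, ?_⟩
    intro g hg hpg
    rw [hpe] at hpg
    exact star v u hv hu g hg hpg.2 hpg.1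
  · exfalso
    have hS : ∀ g ∈ H.filter (fun e => e ∩ R = ∅), u ∈ g →
        g ∈ H.filter (fun e => e ∩ R = ∅ ∧ (e ∩ S).Nonempty) := by
      intro g hg hug
      rcases key g hg with h | h
      · exact (hdis u (h hug) hu).elim
      · exact h
    have he' := hS e he hpe'.1
    have hf' := hS f hf hpf'.1
    have hcc : c e = c f := by
      by_contra hne
      exact Finset.disjoint_left.1 (hc2 e he' f hf' hne) hpe'.1 hpf'.1
    have tri : ∀ g ∈ H.filter (fun e => e ∩ R = ∅ ∧ (e ∩ S).Nonempty), u ∈ g → v ∈ g →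
        g = {c g, u, v} := by
      intro g hg hug hvg
      symm
      apply Finset.eq_of_subset_of_card_le
      · intro x hx
        simp only [Finset.mem_insert, Finset.mem_singleton] at hx
        rcases hx with rfl | rfl | rfl
        · exact (hc1 g hg).1
        · exact hug
        · exact hvg
      · have h1 : c g ≠ u := fun h => hdis u (h ▸ (hc1 g hg).2.1) hu
        have h2 : c g ≠ v := fun h => hdis v (h ▸ (hc1 g hg).2.1) hv
        rw [h3 g (Finset.mem_filter.1 hg).1, Finset.card_eq_three.2 ⟨c g, u, v, h1, h2, huv, rfl⟩]
    apply hef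
    rw [tri e he' hpe'.1 hpe'.2, tri f hf' hpf'.1 hpf'.2, hcc]

/-- The number of pairs of degree at least two is at most the number of vertices. -/
lemma edges_le [Fintype V] (H : Finset (Finset V)) (h3 : ∀ e ∈ H, e.card = 3) (R T S : Finset V)
    (hTS : Disjoint T S) (hcov : ∀ v, v ∈ R ∨ v ∈ T ∨ v ∈ S)
    (hst : DisjointStars (H.filter (fun e => e ∩ R = ∅ ∧ (e ∩ S).Nonempty)) T S)
    (hqb : QuasiBipartite T (H.filter (fun e => e ⊆ T)))
    (E : Finset (Finset V)) (hE2 : ∀ p ∈ E, p.card = 2)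
    (hE : ∀ p ∈ E, 2 ≤ ((H.filter (fun e => e ∩ R = ∅)).filter (fun e => p ⊆ e)).card) :
    E.card ≤ Fintype.card V := by
  classical
  obtain ⟨c, hc1, hc2⟩ := hst
  obtain ⟨s, t, x, y, z, hx, hy, hz, hxy, hxz, hyz, hun, hform⟩ := hqb
  have hdis : ∀ x, x ∈ T → x ∈ S → False := fun x hx hy => (Finset.disjoint_left.1 hTS hx hy)
  have hcl := classify H h3 R T S hTS hcov c hc1 hc2
  rw [← Finset.card_univ]
  let r : Finset V → V → Prop := fun p v => v ∈ p ∧ (v ∈ S ∨ (p ⊆ T ∧ ∃ k, v = x k))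
  have hT2 : ∀ p ∈ E, p ⊆ T → ∃ k, p = {x k, y k} := by
    intro p hp hpT
    rcases hcl p (hE2 p hp) (hE p hp) with ⟨_, h⟩ | ⟨a, v, rfl, ha, hv, h⟩
    · obtain ⟨e, he, f, hf, hef⟩ := Finset.one_lt_card.1 (hE p hp)
      obtain ⟨he, hpe⟩ := Finset.mem_filter.1 he
      obtain ⟨hf, hpf⟩ := Finset.mem_filter.1 hf
      obtain ⟨k, j, rfl⟩ := hform e (Finset.mem_filter.2 ⟨(Finset.mem_filter.1 he).1, h e he hpe⟩)
      obtain ⟨k', j', rfl⟩ := hform f (Finset.mem_filter.2 ⟨(Finset.mem_filter.1 hf).1, h f hf hpf⟩)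
      obtain ⟨u, v, huv, rfl⟩ := Finset.card_eq_two.1 (hE2 p hp)
      refine ⟨k, ?_⟩
      simp only [Finset.insert_subset_iff, Finset.singleton_subset_iff, Finset.mem_insert,
        Finset.mem_singleton] at hpe hpf
      have hkj : ¬ (k = k' ∧ j = j') := by
        rintro ⟨rfl, rfl⟩; exact hef rfl
      have hx' : ∀ a b, x a = x b → a = b := fun a b h => hx h
      have hy' : ∀ a b, y a = y b → a = b := fun a b h => hy h
      have hz' : ∀ a b, z a = z b → a = b := fun a b h => hz h
      clear hform hun hcl hE hE2 h he hf hef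
      obtain ⟨h1, h2⟩ := hpe
      obtain ⟨h3, h4⟩ := hpf
      rcases h1 with rfl | rfl | rfl <;> rcases h2 with rfl | rfl | rfl <;>
        first
          | rfl
          | exact Finset.pair_comm _ _
          | (exfalso; grind)
    · exact (hdis v (hpT (by simp)) hv).elim
  refine Finset.card_le_card_of_forall_subsingleton r ?_ ?_
  · intro p hp
    rcases hcl p (hE2 p hp) (hE p hp) with ⟨hpT, h⟩ | ⟨a, v, rfl, ha, hv, h⟩
    · obtain ⟨k, rfl⟩ := hT2 p hp hpT
      exact ⟨x k, Finset.mem_univ _, by simp, Or.inr ⟨hpT, k, rfl⟩⟩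
    · exact ⟨v, Finset.mem_univ _, by simp, Or.inl hv⟩
  · intro v _ p hp q hq
    obtain ⟨hpE, hvp, hp⟩ := hp
    obtain ⟨hqE, hvq, hq⟩ := hq
    rcases hp with hvS | ⟨hpT, k, rfl⟩
    · have main : ∀ p ∈ E, v ∈ p → ∃ e ∈ H.filter (fun e => e ∩ R = ∅ ∧ (e ∩ S).Nonempty),
          v ∈ e ∧ p = {c e, v} := by
        intro p hp hvp
        rcases hcl p (hE2 p hp) (hE p hp) with ⟨hpT, h⟩ | ⟨a, w, rfl, ha, hw, h⟩
        · exact (hdis v (hpT hvp) hvS).elim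
        · have hvw : v = w := by
            simp only [Finset.mem_insert, Finset.mem_singleton] at hvp
            rcases hvp with rfl | rfl
            · exact (hdis v ha hvS).elim
            · rfl
          subst hvw
          obtain ⟨e, he⟩ := Finset.card_pos.1 (lt_of_lt_of_le (by norm_num) (hE _ hp))
          obtain ⟨he, hpe⟩ := Finset.mem_filter.1 he
          obtain ⟨h1, rfl⟩ := h e he hpe
          exact ⟨e, h1, hpe hvp, rfl⟩
      obtain ⟨e, he, hve, rfl⟩ := main p hpE hvp
      obtain ⟨f, hf, hvf, rfl⟩ := main q hqE hvq
      have hcc : c e = c f := by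
        by_contra hne
        exact Finset.disjoint_left.1 (hc2 e he f hf hne) hve hvf
      rw [hcc]
    · rcases hq with hvS | ⟨hqT, _⟩
      · exact (hdis _ (hpT hvp) hvS).elim
      · obtain ⟨k1, rfl⟩ := hT2 p hpE hpT
        obtain ⟨k2, rfl⟩ := hT2 q hqE hqT
        simp only [Finset.mem_insert, Finset.mem_singleton] at hvp hvq
        have e1 : k = k1 := hvp.elim (fun h => hx h) (fun h => (hxy _ _ h).elim)
        have e2 : k = k2 := hvq.elim (fun h => hx h) (fun h => (hxy _ _ h).elim)
        rw [← e1, ← e2]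

/-- Bound for the star part. -/
lemma stars_le (HS : Finset (Finset V)) (h3 : ∀ e ∈ HS, e.card = 3) (T S : Finset V)
    (c : Finset V → V)
    (hc1 : ∀ e ∈ HS, c e ∈ e ∧ c e ∈ T ∧ ∀ x ∈ e, x ≠ c e → x ∈ S)
    (hc2 : ∀ e ∈ HS, ∀ f ∈ HS, c e ≠ c f → Disjoint e f) (a : V) (D : Finset V)
    (hD : D = S.filter (fun v => ∃ e ∈ HS, c e = a ∧ v ∈ e)) :
    HS.card ≤ D.card.choose 2 + (S \ D).card.choose 2 := by
  classical
  rw [← Finset.card_powersetCard 2 D, ← Finset.card_powersetCard 2 (S \ D)]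
  refine le_trans ?_ (Finset.card_union_le _ _)
  have hcard : ∀ e ∈ HS, (e.erase (c e)).card = 2 := by
    intro e he
    rw [Finset.card_erase_of_mem (hc1 e he).1, h3 e he]
  apply Finset.card_le_card_of_injOn (fun e => e.erase (c e))
  · intro e he
    have he : e ∈ HS := he
    simp only [Finset.coe_union, Set.mem_union, Finset.mem_coe, Finset.mem_powersetCard]
    by_cases hca : c e = a
    · left
      refine ⟨?_, hcard e he⟩
      intro x hx
      obtain ⟨hx1, hx2⟩ := Finset.mem_erase.1 hx
      rw [hD]
      exact Finset.mem_filter.2 ⟨(hc1 e he).2.2 x hx2 hx1, e, he, hca, hx2⟩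
    · right
      refine ⟨?_, hcard e he⟩
      intro x hx
      obtain ⟨hx1, hx2⟩ := Finset.mem_erase.1 hx
      refine Finset.mem_sdiff.2 ⟨(hc1 e he).2.2 x hx2 hx1, ?_⟩
      rw [hD]
      intro hxD
      obtain ⟨_, f, hf, hfa, hxf⟩ := Finset.mem_filter.1 hxD
      exact Finset.disjoint_left.1 (hc2 e he f hf (by rw [hfa]; exact hca)) hx2 hxf
  · intro e he f hf hef
    have he : e ∈ HS := he
    have hf : f ∈ HS := hf
    have hef : e.erase (c e) = f.erase (c f) := hef
    have hcc : c e = c f := by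
      by_contra hne
      obtain ⟨x, hx⟩ := Finset.card_pos.1 (by rw [hcard e he]; norm_num : 0 < (e.erase (c e)).card)
      have hx' := hx
      rw [hef] at hx'
      exact Finset.disjoint_left.1 (hc2 e he f hf hne) (Finset.mem_of_mem_erase hx)
        (Finset.mem_of_mem_erase hx')
    rw [← Finset.insert_erase (hc1 e he).1, ← Finset.insert_erase (hc1 f hf).1, hef, hcc]

lemma choose_two_real (k : ℕ) : ((k.choose 2 : ℕ) : ℝ) = (k : ℝ) * (k - 1) / 2 := by
  exact Nat.cast_choose_two ℝ k

/-- Numerical core, case of two large stars. -/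
lemma num_two (L M r t S d h : ℝ) (hL : 1 ≤ L) (hM : 60 ≤ M)
    (hr : 0 ≤ r) (ht : 2 ≤ t) (hsum : r + t + S = L + M)
    (hd1 : L ≤ d) (hd2 : L ≤ S - d)
    (hh : h ≤ 6 * r + t ^ 2 / 8 + (d * (d - 1) / 2 + (S - d) * (S - d - 1) / 2))
    (hrich : (M - 1) * (M - 1 - 1) / 2 + L * (L - 1) / 2 ≤ h) : False := by
  have h1 : d * (d - 1) / 2 + (S - d) * (S - d - 1) / 2
      ≤ L * (L - 1) / 2 + (S - L) * (S - L - 1) / 2 := by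
    nlinarith [mul_nonneg (sub_nonneg.2 hd1) (sub_nonneg.2 hd2)]
  obtain ⟨u, hu⟩ : ∃ u, u = r + t := ⟨_, rfl⟩
  have hS : S = L + M - u := by linarith
  subst hS
  have huM : u ≤ M := by linarith
  have hu2 : 2 ≤ u := by linarith
  have h2 : 6 * r + t ^ 2 / 8 ≤ 6 * (u - 1) + u ^ 2 / 8 := by nlinarith
  have h3 : u ^ 2 / 8 ≤ (u - 1) * u / 4 := by nlinarith
  have h4 : 6 * (u - 1) + (u - 1) * u / 4 < (u - 1) * (M - 1 - u / 2) := by nlinarith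
  nlinarith

/-- Numerical core, case of a large quasi-bipartite part. -/
lemma num_one (L M r t S h : ℝ) (hL : 40 ≤ L) (hM : 60 ≤ M) (hS : 0 ≤ S)
    (hr : 0 ≤ r) (ht : L + 1 ≤ t) (hsum : r + t + S = L + M)
    (hh : h ≤ 6 * r + t ^ 2 / 8 + S * (S - 1) / 2)
    (hrich : (M - 1) * (M - 1 - 1) / 2 + L * (L - 1) / 2 ≤ h) : False := by
  obtain ⟨q, rfl⟩ : ∃ q, t = L + 1 + q := ⟨t - (L + 1), by ring⟩
  have hq : 0 ≤ q := by linarith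
  obtain ⟨W, hW⟩ : ∃ W, W = M - 1 := ⟨_, rfl⟩
  have hsum' : r + q + S = W := by linarith
  have hM' : M = W + 1 := by linarith
  subst hM'
  have hW : 59 ≤ W := by linarith
  have b1 : S * (S - 1) / 2 ≤ S * (W - 1) / 2 := by nlinarith
  have b2 : 6 * r ≤ r * (W - 1) / 2 := by nlinarith
  have b3 : (L + 1 + q) ^ 2 / 8 ≤ (L + 1) ^ 2 / 8 + q * (2 * (L + 1) + W) / 8 := by nlinarith
  have b4 : h ≤ (L + 1) ^ 2 / 8 + (W - q) * (W - 1) / 2 + q * (2 * (L + 1) + W) / 8 := by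
    have : (W - q) = r + S := by linarith
    rw [this]
    linarith
  have c1 : 0 < L * (L - 1) / 2 - (L + 1) ^ 2 / 8 := by nlinarith
  have c2 : 0 < W * (W - 1) / 2 + L * (L - 1) / 2 - (L + 1 + W) ^ 2 / 8 := by
    nlinarith [sq_nonneg (L - W)]
  have hq2 : 0 ≤ W - q := by linarith
  have d1 := mul_nonneg hq2 c1.le
  have d2 := mul_nonneg hq c2.le
  have d3 : 0 < (W - q) * (L * (L - 1) / 2 - (L + 1) ^ 2 / 8)
      + q * (W * (W - 1) / 2 + L * (L - 1) / 2 - (L + 1 + W) ^ 2 / 8) := by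
    rcases hq.eq_or_lt with h0 | h0
    · rw [← h0]
      nlinarith
    · nlinarith [mul_pos h0 c2]
  have d4 : W * (W * (W - 1) / 2 + L * (L - 1) / 2 -
      ((L + 1) ^ 2 / 8 + (W - q) * (W - 1) / 2 + q * (2 * (L + 1) + W) / 8)) =
      (W - q) * (L * (L - 1) / 2 - (L + 1) ^ 2 / 8)
      + q * (W * (W - 1) / 2 + L * (L - 1) / 2 - (L + 1 + W) ^ 2 / 8) := by ring
  have d5 : W * (W * (W - 1) / 2 + L * (L - 1) / 2 -
      ((L + 1) ^ 2 / 8 + (W - q) * (W - 1) / 2 + q * (2 * (L + 1) + W) / 8)) ≤ 0 := by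
    apply mul_nonpos_of_nonneg_of_nonpos
    · linarith
    · have : (W + 1 - 1) * (W + 1 - 1 - 1) / 2 = W * (W - 1) / 2 := by ring
      linarith
  linarith

/-- In a rich color all pairs of large degree share a vertex. -/
lemma rich_center [Fintype V] [Nonempty V] (H : Finset (Finset V)) (h3 : ∀ e ∈ H, e.card = 3)
    (R T S : Finset V) (hRT : Disjoint R T) (hRS : Disjoint R S)
    (hTS : Disjoint T S) (hcov : R ∪ T ∪ S = Finset.univ)
    (hst : DisjointStars (H.filter (fun e => e ∩ R = ∅ ∧ (e ∩ S).Nonempty)) T S)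
    (hR : (H.filter (fun e => (e ∩ R).Nonempty)).card ≤ 6 * R.card)
    (hT : ((H.filter (fun e => e ⊆ T)).card : ℝ) ≤ (T.card : ℝ) ^ 2 / 8)
    (L M : ℝ) (hL : 40 ≤ L) (hM : 60 ≤ M) (hLM : L + M = Fintype.card V)
    (hrich : (M - 1) * (M - 1 - 1) / 2 + L * (L - 1) / 2 ≤ (H.card : ℝ)) :
    ∃ a : V, ∀ p : Finset V, p.card = 2 →
      L - 1 < (((H.filter (fun e => e ∩ R = ∅)).filter (fun e => p ⊆ e)).card : ℝ) → a ∈ p := by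
  classical
  obtain ⟨c, hc1, hc2⟩ := hst
  have hcov' : ∀ v, v ∈ R ∨ v ∈ T ∨ v ∈ S := by
    intro v
    have := Finset.mem_univ v
    rw [← hcov] at this
    simpa [or_assoc] using this
  have hcl := classify H h3 R T S hTS hcov' c hc1 hc2
  have hsumN : R.card + T.card + S.card = Fintype.card V := by
    rw [← Finset.card_univ, ← hcov, Finset.card_union_of_disjoint, Finset.card_union_of_disjoint hRT]
    exact Finset.disjoint_union_left.2 ⟨hRS, hTS⟩
  have hsum : (R.card : ℝ) + T.card + S.card = L + M := by
    rw [hLM]; exact_mod_cast hsumN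
  set HS := H.filter (fun e => e ∩ R = ∅ ∧ (e ∩ S).Nonempty) with hHS
  have hHS3 : ∀ e ∈ HS, e.card = 3 := fun e he => h3 e (Finset.mem_filter.1 he).1
  have hH : (H.card : ℝ) ≤ 6 * R.card + (T.card : ℝ) ^ 2 / 8 + HS.card := by
    have hsub : H ⊆ (H.filter (fun e => (e ∩ R).Nonempty) ∪ H.filter (fun e => e ⊆ T)) ∪ HS := by
      intro e he
      simp only [Finset.mem_union, Finset.mem_filter, hHS]
      by_cases h1 : (e ∩ R).Nonempty
      · exact Or.inl (Or.inl ⟨he, h1⟩)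
      · by_cases h2 : (e ∩ S).Nonempty
        · exact Or.inr ⟨he, Finset.not_nonempty_iff_eq_empty.1 h1, h2⟩
        · refine Or.inl (Or.inr ⟨he, ?_⟩)
          intro x hx
          rcases hcov' x with h | h | h
          · exact absurd ⟨x, Finset.mem_inter.2 ⟨hx, h⟩⟩ h1
          · exact h
          · exact absurd ⟨x, Finset.mem_inter.2 ⟨hx, h⟩⟩ h2
    have h1 := (Finset.card_le_card hsub).trans ((Finset.card_union_le _ _).trans
      (Nat.add_le_add_right (Finset.card_union_le _ _) _))
    have h1' : (H.card : ℝ) ≤ (H.filter (fun e => (e ∩ R).Nonempty)).card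
      + (H.filter (fun e => e ⊆ T)).card + HS.card := by exact_mod_cast h1
    have hR' : ((H.filter (fun e => (e ∩ R).Nonempty)).card : ℝ) ≤ 6 * R.card := by
      exact_mod_cast hR
    linarith
  obtain ⟨D, hD⟩ : ∃ D : V → Finset V,
      ∀ a, D a = S.filter (fun v => ∃ e ∈ HS, c e = a ∧ v ∈ e) := ⟨_, fun a => rfl⟩
  have hDS : ∀ a, D a ⊆ S := fun a => by rw [hD]; exact Finset.filter_subset _ _
  have hHSle : ∀ a, (HS.card : ℝ) ≤ ((D a).card : ℝ) * ((D a).card - 1) / 2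
      + ((S.card : ℝ) - (D a).card) * ((S.card : ℝ) - (D a).card - 1) / 2 := by
    intro a
    have h1 := stars_le HS hHS3 T S c hc1 hc2 a (D a) (hD a)
    have h2 : (HS.card : ℝ) ≤ (((D a).card.choose 2 : ℕ) : ℝ)
        + (((S \ D a).card.choose 2 : ℕ) : ℝ) := by exact_mod_cast h1
    rw [choose_two_real, choose_two_real, Finset.cast_card_sdiff (hDS a)] at h2
    exact h2
  -- every pair of large degree is a star edge
  have hstar : ∀ p : Finset V, p.card = 2 →
      L - 1 < (((H.filter (fun e => e ∩ R = ∅)).filter (fun e => p ⊆ e)).card : ℝ) →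
      ∃ a, a ∈ p ∧ a ∈ T ∧ L < (D a).card := by
    intro p hp hdeg
    have hd2 : 2 ≤ ((H.filter (fun e => e ∩ R = ∅)).filter (fun e => p ⊆ e)).card := by
      have : (2 : ℝ) ≤ (((H.filter (fun e => e ∩ R = ∅)).filter (fun e => p ⊆ e)).card : ℝ) := by
        linarith
      exact_mod_cast this
    have hF3 : ∀ e ∈ (H.filter (fun e => e ∩ R = ∅)).filter (fun e => p ⊆ e), e.card = 3 :=
      fun e he => h3 e (Finset.mem_filter.1 (Finset.mem_filter.1 he).1).1
    have hFp : ∀ e ∈ (H.filter (fun e => e ∩ R = ∅)).filter (fun e => p ⊆ e), p ⊆ e :=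
      fun e he => (Finset.mem_filter.1 he).2
    rcases hcl p hp hd2 with ⟨hpT, h⟩ | ⟨a, v, rfl, ha, hv, h⟩
    · exfalso
      have h1 := card_le_third _ p (T \ p) hp hF3 hFp (by
        intro e he
        exact Finset.sdiff_subset_sdiff (h e (Finset.mem_filter.1 he).1 (hFp e he)) le_rfl)
      have h2 : (((H.filter (fun e => e ∩ R = ∅)).filter (fun e => p ⊆ e)).card : ℝ)
          ≤ ((T \ p).card : ℝ) := by exact_mod_cast h1
      rw [Finset.cast_card_sdiff hpT, hp] at h2
      push_cast at h2
      have h4 := hHSle (Classical.arbitrary V)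
      set d := (D (Classical.arbitrary V)).card
      have hdS : (d : ℝ) ≤ S.card := by
        exact_mod_cast Finset.card_le_card (hDS (Classical.arbitrary V))
      have hd0 : (0 : ℝ) ≤ d := Nat.cast_nonneg _
      refine num_one L M R.card T.card S.card H.card hL hM (Nat.cast_nonneg _) (Nat.cast_nonneg _)
        (by linarith) hsum ?_ hrich
      nlinarith [mul_nonneg hd0 (sub_nonneg.2 hdS)]
    · refine ⟨a, by simp, ha, ?_⟩
      have hvD : v ∈ D a := by
        obtain ⟨e, he⟩ := Finset.card_pos.1 (lt_of_lt_of_le (by norm_num) hd2)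
        obtain ⟨he, hpe⟩ := Finset.mem_filter.1 he
        rw [hD]
        exact Finset.mem_filter.2 ⟨hv, e, (h e he hpe).1, (h e he hpe).2, hpe (by simp)⟩
      have h1 := card_le_third _ ({a, v} : Finset V) ((D a).erase v) hp hF3 hFp (by
        intro e he x hx
        obtain ⟨h1, h2⟩ := h e (Finset.mem_filter.1 he).1 (hFp e he)
        obtain ⟨hxe, hxp⟩ := Finset.mem_sdiff.1 hx
        simp only [Finset.mem_insert, Finset.mem_singleton, not_or] at hxp
        refine Finset.mem_erase.2 ⟨hxp.2, ?_⟩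
        rw [hD]
        exact Finset.mem_filter.2 ⟨(hc1 e h1).2.2 x hxe (by rw [h2]; exact hxp.1), e, h1, h2, hxe⟩)
      rw [Finset.card_erase_of_mem hvD] at h1
      have hpos : 1 ≤ (D a).card := Finset.card_pos.2 ⟨v, hvD⟩
      have h2 : (((H.filter (fun e => e ∩ R = ∅)).filter (fun e => {a, v} ⊆ e)).card : ℝ)
          ≤ (D a).card - 1 := by
        have : ((H.filter (fun e => e ∩ R = ∅)).filter (fun e => {a, v} ⊆ e)).card + 1
          ≤ (D a).card := by omega
        have h' : (((H.filter (fun e => e ∩ R = ∅)).filter (fun e => {a, v} ⊆ e)).card : ℝ) + 1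
          ≤ (D a).card := by exact_mod_cast this
        linarith
      linarith
  have huniq : ∀ a b, a ∈ T → b ∈ T → L < (D a).card → L < (D b).card → a = b := by
    intro a b ha hb hDa hDb
    by_contra hab
    have ht : (2 : ℝ) ≤ T.card := by
      have : ({a, b} : Finset V) ⊆ T := by simp [Finset.insert_subset_iff, ha, hb]
      have := Finset.card_le_card this
      rw [Finset.card_pair hab] at this
      exact_mod_cast this
    have hdisj : Disjoint (D a) (D b) := by
      rw [Finset.disjoint_left]
      intro x hxa hxb
      rw [hD] at hxa hxb
      obtain ⟨_, e, he, hea, hxe⟩ := Finset.mem_filter.1 hxa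
      obtain ⟨_, f, hf, hfb, hxf⟩ := Finset.mem_filter.1 hxb
      exact Finset.disjoint_left.1 (hc2 e he f hf (by rw [hea, hfb]; exact hab)) hxe hxf
    have hle : ((D a).card : ℝ) + (D b).card ≤ S.card := by
      have := Finset.card_le_card (Finset.union_subset (hDS a) (hDS b))
      rw [Finset.card_union_of_disjoint hdisj] at this
      exact_mod_cast this
    exact num_two L M R.card T.card S.card (D a).card H.card (by linarith) hM (Nat.cast_nonneg _)
      ht hsum hDa.le (by linarith) (by linarith [hHSle a]) hrich
  by_cases hex : ∃ p : Finset V, p.card = 2 ∧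
      L - 1 < (((H.filter (fun e => e ∩ R = ∅)).filter (fun e => p ⊆ e)).card : ℝ)
  · obtain ⟨p, hp, hdeg⟩ := hex
    obtain ⟨a, _, haT, haD⟩ := hstar p hp hdeg
    refine ⟨a, fun q hq hqdeg => ?_⟩
    obtain ⟨b, hbq, hbT, hbD⟩ := hstar q hq hqdeg
    rw [huniq a b haT hbT haD hbD]
    exact hbq
  · push Not at hex
    exact ⟨Classical.arbitrary V, fun p hp h => absurd h (not_lt.2 (hex p hp))⟩

/-- Pairs meeting a set of at most `m` vertices. -/
lemma pairs_meeting [Fintype V] (X : Finset V) (m : ℕ) (hX : X.card ≤ m)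
    (hm : m ≤ Fintype.card V) (F : Finset (Finset V)) (hF2 : ∀ p ∈ F, p.card = 2)
    (hFX : ∀ p ∈ F, ∃ a ∈ X, a ∈ p) :
    (F.card : ℝ) ≤ (m : ℝ) * Fintype.card V - m * (m + 1) / 2 := by
  classical
  have hdisj : Disjoint F (Finset.powersetCard 2 Xᶜ) := by
    rw [Finset.disjoint_left]
    intro p hp hp2
    obtain ⟨a, ha, hap⟩ := hFX p hp
    have := (Finset.mem_powersetCard.1 hp2).1 hap
    exact (Finset.mem_compl.1 this) ha
  have hsub : F ∪ Finset.powersetCard 2 Xᶜ ⊆ Finset.powersetCard 2 Finset.univ := by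
    intro p hp
    rcases Finset.mem_union.1 hp with h | h
    · exact Finset.mem_powersetCard.2 ⟨Finset.subset_univ _, hF2 p h⟩
    · exact Finset.mem_powersetCard.2 ⟨Finset.subset_univ _, (Finset.mem_powersetCard.1 h).2⟩
  have h1 := Finset.card_le_card hsub
  rw [Finset.card_union_of_disjoint hdisj, Finset.card_powersetCard, Finset.card_powersetCard,
    Finset.card_compl, Finset.card_univ] at h1
  have h2 : (Fintype.card V - m).choose 2 ≤ (Fintype.card V - X.card).choose 2 :=
    Nat.choose_le_choose 2 (by omega)
  have h3 : F.card + (Fintype.card V - m).choose 2 ≤ (Fintype.card V).choose 2 := by omega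
  have h4 : (F.card : ℝ) + (((Fintype.card V - m).choose 2 : ℕ) : ℝ)
      ≤ (((Fintype.card V).choose 2 : ℕ) : ℝ) := by exact_mod_cast h3
  rw [choose_two_real, choose_two_real, Nat.cast_sub hm] at h4
  nlinarith

section Coloring

variable {n N : ℕ} (χ : Finset (Fin N) → Fin n) (VR : Fin n → Finset (Fin N))

/-- The number of blank triples containing `p`. -/
def bl (p : Finset (Fin N)) : ℕ := ((BlankSet χ VR).filter (fun e => p ⊆ e)).card

/-- The number of non-blank triples of color `i` containing `p`. -/
def dg (i : Fin n) (p : Finset (Fin N)) : ℕ := ((Hhat χ VR i).filter (fun e => p ⊆ e)).card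

lemma deg_sum (p : Finset (Fin N)) (hp : p.card = 2) :
    N ≤ 2 + bl χ VR p + ∑ i, dg χ VR i p := by
  classical
  have hsub : pᶜ.image (fun v => insert v p) ⊆ (BlankSet χ VR).filter (fun e => p ⊆ e) ∪
      Finset.univ.biUnion (fun i => (Hhat χ VR i).filter (fun e => p ⊆ e)) := by
    intro e he
    obtain ⟨v, hv, rfl⟩ := Finset.mem_image.1 he
    have hv' : v ∉ p := Finset.mem_compl.1 hv
    have hc : (insert v p).card = 3 := by rw [Finset.card_insert_of_notMem hv', hp]
    by_cases hb : (insert v p ∩ VR (χ (insert v p))).Nonempty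
    · refine Finset.mem_union_left _ (Finset.mem_filter.2 ⟨?_, Finset.subset_insert _ _⟩)
      exact Finset.mem_filter.2 ⟨Finset.mem_univ _, hc, hb⟩
    · refine Finset.mem_union_right _ (Finset.mem_biUnion.2 ⟨χ (insert v p), Finset.mem_univ _, ?_⟩)
      refine Finset.mem_filter.2 ⟨Finset.mem_filter.2 ⟨?_, Finset.not_nonempty_iff_eq_empty.1 hb⟩,
        Finset.subset_insert _ _⟩
      exact Finset.mem_filter.2 ⟨Finset.mem_univ _, hc, rfl⟩
  have h1 := (Finset.card_le_card hsub).trans ((Finset.card_union_le _ _).trans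
    (Nat.add_le_add_left Finset.card_biUnion_le _))
  have hinj : Set.InjOn (fun v => insert v p) (pᶜ : Finset (Fin N)) := by
    intro v hv w hw hvw
    have hv' : v ∉ p := Finset.mem_compl.1 hv
    have : v ∈ insert w p := by
      have hvw : insert v p = insert w p := hvw
      rw [← hvw]; exact Finset.mem_insert_self _ _
    rcases Finset.mem_insert.1 this with h | h
    · exact h
    · exact absurd h hv'
  rw [Finset.card_image_of_injOn hinj, Finset.card_compl, hp, Fintype.card_fin] at h1
  unfold bl dg
  omega

lemma blank_sum (hR : ∀ i, (HRpart χ VR i).card ≤ 6 * (VR i).card) :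
    ∑ p ∈ Finset.powersetCard 2 (Finset.univ : Finset (Fin N)), bl χ VR p ≤ 18 * n * N := by
  classical
  have h1 : ∑ p ∈ Finset.powersetCard 2 (Finset.univ : Finset (Fin N)), bl χ VR p
      = ∑ e ∈ BlankSet χ VR,
        ((Finset.powersetCard 2 (Finset.univ : Finset (Fin N))).filter (fun p => p ⊆ e)).card := by
    have h := Finset.sum_card_bipartiteAbove_eq_sum_card_bipartiteBelow
      (s := Finset.powersetCard 2 (Finset.univ : Finset (Fin N))) (t := BlankSet χ VR)
      (fun (p e : Finset (Fin N)) => p ⊆ e)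
    simp only [Finset.bipartiteAbove, Finset.bipartiteBelow] at h
    simp only [bl]
    exact h
  have h2 : ∀ e ∈ BlankSet χ VR,
      ((Finset.powersetCard 2 (Finset.univ : Finset (Fin N))).filter (fun p => p ⊆ e)).card
        ≤ 3 := by
    intro e he
    have he3 : e.card = 3 := (Finset.mem_filter.1 he).2.1
    have hs : (Finset.powersetCard 2 (Finset.univ : Finset (Fin N))).filter (fun p => p ⊆ e)
        ⊆ Finset.powersetCard 2 e := by
      intro p hp
      obtain ⟨hp1, hp2⟩ := Finset.mem_filter.1 hp
      exact Finset.mem_powersetCard.2 ⟨hp2, (Finset.mem_powersetCard.1 hp1).2⟩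
    have := Finset.card_le_card hs
    rw [Finset.card_powersetCard, he3] at this
    exact this
  have h3 : (BlankSet χ VR).card ≤ 6 * n * N := by
    have hs : BlankSet χ VR ⊆ Finset.univ.biUnion (fun i => HRpart χ VR i) := by
      intro e he
      obtain ⟨_, he3, hb⟩ := Finset.mem_filter.1 he
      refine Finset.mem_biUnion.2 ⟨χ e, Finset.mem_univ _, Finset.mem_filter.2 ⟨?_, hb⟩⟩
      exact Finset.mem_filter.2 ⟨Finset.mem_univ _, he3, rfl⟩
    calc (BlankSet χ VR).card ≤ ∑ i, (HRpart χ VR i).card :=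
          (Finset.card_le_card hs).trans Finset.card_biUnion_le
      _ ≤ ∑ _i : Fin n, 6 * N := by
          apply Finset.sum_le_sum
          intro i _
          have : (VR i).card ≤ N := by simpa using Finset.card_le_univ (VR i)
          have := hR i
          omega
      _ = 6 * n * N := by simp; ring
  rw [h1]
  calc _ ≤ ∑ _e ∈ BlankSet χ VR, 3 := Finset.sum_le_sum h2
    _ = (BlankSet χ VR).card * 3 := by simp
    _ ≤ (6 * n * N) * 3 := Nat.mul_le_mul_right _ h3
    _ = 18 * n * N := by ring

end Coloring

/-- Double counting of covered pairs by private and all edges. -/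
lemma cover_count {α : Type*} [DecidableEq α] {n : ℕ} (Q : Finset α) (E : Fin n → Finset α)
    (hcov : ∀ p ∈ Q, ∃ i, p ∈ E i) :
    2 * Q.card ≤ ∑ i, (E i).card
      + ∑ i, ((E i).filter (fun p => ∀ j, j ≠ i → p ∉ E j)).card := by
  classical
  have hswap : ∀ F : Fin n → Finset α, ∑ p ∈ Q, (Finset.univ.filter (fun i => p ∈ F i)).card
      ≤ ∑ i, (F i).card := by
    intro F
    have h1 : ∑ p ∈ Q, (Finset.univ.filter (fun i => p ∈ F i)).card
        = ∑ i, (Q.filter (fun p => p ∈ F i)).card :=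
      Finset.sum_card_bipartiteAbove_eq_sum_card_bipartiteBelow (fun p i => p ∈ F i)
    rw [h1]
    apply Finset.sum_le_sum
    intro i _
    apply Finset.card_le_card
    intro p hp
    exact (Finset.mem_filter.1 hp).2
  refine le_trans ?_ (Nat.add_le_add (hswap E) (hswap _))
  rw [← Finset.sum_add_distrib, mul_comm, ← smul_eq_mul]
  apply Finset.card_nsmul_le_sum
  intro p hp
  obtain ⟨i, hi⟩ := hcov p hp
  by_cases hj : ∃ j, j ≠ i ∧ p ∈ E j
  · obtain ⟨j, hji, hj⟩ := hj
    have hs : ({i, j} : Finset (Fin n)) ⊆ Finset.univ.filter (fun i => p ∈ E i) := by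
      simp [Finset.insert_subset_iff, hi, hj]
    have := Finset.card_le_card hs
    rw [Finset.card_pair hji.symm] at this
    omega
  · push Not at hj
    have h1 : 1 ≤ (Finset.univ.filter (fun i => p ∈ E i)).card :=
      Finset.card_pos.2 ⟨i, by simp [hi]⟩
    have h2 : 1 ≤ (Finset.univ.filter
        (fun i => p ∈ (E i).filter (fun p => ∀ j, j ≠ i → p ∉ E j))).card :=
      Finset.card_pos.2 ⟨i, by
        simp only [Finset.mem_filter, Finset.mem_univ, true_and]
        exact ⟨hi, hj⟩⟩
    omega

end Aux

open scoped Classical in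
theorem main_counting_ineq (n N : ℕ) (hn : 41 ≤ n) (γ : ℝ)
    (hγ : γ = ((N : ℝ) - 7 * Real.sqrt n) / n) (hγ1 : 1.9 < γ) (hγ2 : γ < 2)
    (χ : Finset (Fin N) → Fin n)
    (hfree : ∀ i : Fin n, ¬ HasLoosePath (colorClass χ i))
    (VR VT VS : Fin n → Finset (Fin N))
    (hpart : ∀ i, Disjoint (VR i) (VT i) ∧ Disjoint (VR i) (VS i) ∧ Disjoint (VT i) (VS i) ∧
      VR i ∪ VT i ∪ VS i = Finset.univ)
    (hR : ∀ i, (HRpart χ VR i).card ≤ 6 * (VR i).card)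
    (hTqb : ∀ i, QuasiBipartite (VT i) (HTpart χ VT i))
    (hTcard : ∀ i, ((HTpart χ VT i).card : ℝ) ≤ ((VT i).card : ℝ) ^ 2 / 8)
    (hSstars : ∀ i, DisjointStars (HSpart χ VR VS i) (VT i) (VS i))
    (G : Fin n → SimpleGraph (Fin N))
    (hG : ∀ i u v, (G i).Adj u v ↔ u ≠ v ∧
      2 ≤ ((Hhat χ VR i).filter (fun e => u ∈ e ∧ v ∈ e)).card ∧
      ((((BlankSet χ VR).filter (fun e => u ∈ e ∧ v ∈ e)).card : ℝ) < 6 * Real.sqrt n)) :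
    realChoose2 (N : ℝ) - 6 * ((n : ℝ) * Real.sqrt n) - 21 * (n : ℝ)
      ≤ (n : ℝ) * (N : ℝ)
        - ((Finset.univ.filter (fun i : Fin n => Rich n N χ i)).card : ℝ) ^ 2 / 4 := by
  have hn0 : (41 : ℝ) ≤ n := by exact_mod_cast hn
  obtain ⟨q, hq⟩ : ∃ q, q = Real.sqrt n := ⟨_, rfl⟩
  have hqq : q * q = n := by rw [hq]; exact Real.mul_self_sqrt (by linarith)
  have hq0 : 0 ≤ q := by rw [hq]; exact Real.sqrt_nonneg _
  have hq6 : 6 ≤ q := by nlinarith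
  rw [← hq] at hγ ⊢
  have hnpos : (0 : ℝ) < n := by linarith
  have hγn : (N : ℝ) = γ * n + 7 * q := by
    rw [hγ]; field_simp; ring
  have hN1 : 1.9 * (n : ℝ) + 7 * q ≤ N := by rw [hγn]; nlinarith
  have hN2 : (N : ℝ) ≤ 2 * n + 7 * q := by rw [hγn]; nlinarith
  clear hγ hγ1 hγ2 hγn
  have hNn : n ≤ N := by
    have : (n : ℝ) ≤ N := by linarith
    exact_mod_cast this
  have : Nonempty (Fin N) := ⟨⟨0, by omega⟩⟩
  have hcov : ∀ i v, v ∈ VR i ∨ v ∈ VT i ∨ v ∈ VS i := by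
    intro i v
    have := Finset.mem_univ v
    rw [← (hpart i).2.2.2] at this
    simpa [or_assoc] using this
  have h3 : ∀ i, ∀ e ∈ colorClass χ i, e.card = 3 := fun i e he => (Finset.mem_filter.1 he).2.1
  obtain ⟨P, hP⟩ : ∃ P : Finset (Finset (Fin N)), P = Finset.powersetCard 2 Finset.univ := ⟨_, rfl⟩
  have hP2 : ∀ p ∈ P, p.card = 2 := by
    intro p hp; rw [hP] at hp; exact (Finset.mem_powersetCard.1 hp).2
  obtain ⟨Q, hQ⟩ : ∃ Q : Finset (Finset (Fin N)),
    Q = P.filter (fun p => (Aux.bl χ VR p : ℝ) < 6 * q) := ⟨_, rfl⟩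
  have hQm : ∀ p, p ∈ Q ↔ p ∈ P ∧ (Aux.bl χ VR p : ℝ) < 6 * q := by
    intro p; rw [hQ, Finset.mem_filter]
  obtain ⟨E, hE⟩ : ∃ E : Fin n → Finset (Finset (Fin N)),
    ∀ i, E i = Q.filter (fun p => 2 ≤ Aux.dg χ VR i p) := ⟨_, fun i => rfl⟩
  have hEm : ∀ i p, p ∈ E i ↔ p ∈ Q ∧ 2 ≤ Aux.dg χ VR i p := by
    intro i p; rw [hE, Finset.mem_filter]
  have hEcard : ∀ i, (E i).card ≤ N := by
    intro i
    have := Aux.edges_le (colorClass χ i) (h3 i) (VR i) (VT i) (VS i) (hpart i).2.2.1 (hcov i)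
      (hSstars i) (hTqb i) (E i) (fun p hp => hP2 p ((hQm p).1 ((hEm i p).1 hp).1).1)
      (fun p hp => ((hEm i p).1 hp).2)
    simpa using this
  -- the number of pairs in many blank triples
  have hbad : (P.card : ℝ) ≤ Q.card + 3 * q * N := by
    have h1 := Aux.blank_sum χ VR hR
    rw [← hP] at h1
    have h2 : ((∑ p ∈ P, Aux.bl χ VR p : ℕ) : ℝ) ≤ 18 * n * N := by exact_mod_cast h1
    have h4 : ((P \ Q).card : ℝ) * (6 * q) ≤ ((∑ p ∈ P, Aux.bl χ VR p : ℕ) : ℝ) := by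
      push_cast
      rw [← nsmul_eq_mul]
      refine le_trans (Finset.card_nsmul_le_sum (P \ Q) (fun p => (Aux.bl χ VR p : ℝ)) _ ?_)
        (Finset.sum_le_sum_of_subset_of_nonneg Finset.sdiff_subset
          (fun _ _ _ => Nat.cast_nonneg _))
      intro p hp
      obtain ⟨hp1, hp2⟩ := Finset.mem_sdiff.1 hp
      by_contra hlt
      exact hp2 ((hQm p).2 ⟨hp1, not_le.1 hlt⟩)
    have hQP : Q ⊆ P := by rw [hQ]; exact Finset.filter_subset _ _
    rw [Finset.cast_card_sdiff hQP] at h4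
    have h5 : ((P.card : ℝ) - Q.card) * (6 * q) ≤ (3 * q * N) * (6 * q) := by
      have : (3 * q * N) * (6 * q) = 18 * (q * q) * N := by ring
      rw [this, hqq]; linarith
    have := le_of_mul_le_mul_right h5 (by linarith)
    linarith
  have hdeg : ∀ p ∈ Q, (N : ℝ) < 2 + 6 * q + ∑ i, (Aux.dg χ VR i p : ℝ) := by
    intro p hp
    have h1 := Aux.deg_sum χ VR p (hP2 p ((hQm p).1 hp).1)
    have h2 : (N : ℝ) ≤ 2 + Aux.bl χ VR p + ∑ i, (Aux.dg χ VR i p : ℝ) := by exact_mod_cast h1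
    have := ((hQm p).1 hp).2
    linarith
  have hQcov : ∀ p ∈ Q, ∃ i, p ∈ E i := by
    intro p hp
    by_contra hno
    push Not at hno
    have h1 : ∑ i, (Aux.dg χ VR i p : ℝ) ≤ ∑ _i : Fin n, (1 : ℝ) := by
      apply Finset.sum_le_sum
      intro i _
      have : Aux.dg χ VR i p ≤ 1 := by
        by_contra hlt
        exact hno i ((hEm i p).2 ⟨hp, by omega⟩)
      exact_mod_cast this
    simp only [Finset.sum_const, Finset.card_univ, Fintype.card_fin, nsmul_eq_mul, mul_one] at h1
    have := hdeg p hp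
    linarith
  have hcount := Aux.cover_count Q E hQcov
  obtain ⟨Pr, hPr⟩ : ∃ Pr : Fin n → Finset (Finset (Fin N)),
    ∀ i, Pr i = (E i).filter (fun p => ∀ j, j ≠ i → p ∉ E j) := ⟨_, fun i => rfl⟩
  have hPrm : ∀ i p, p ∈ Pr i ↔ p ∈ E i ∧ ∀ j, j ≠ i → p ∉ E j := by
    intro i p; rw [hPr, Finset.mem_filter]
  have hcount' : 2 * Q.card ≤ ∑ i, (E i).card + ∑ i, (Pr i).card := by
    refine hcount.trans (le_of_eq ?_)
    congr 1
    apply Finset.sum_congr rfl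
    intro i _
    rw [hPr]
  -- private edges have large degree
  have hprdeg : ∀ i, ∀ p ∈ Pr i, (N : ℝ) - n - 6 * q - 1 < Aux.dg χ VR i p := by
    intro i p hp
    obtain ⟨hpE, hpj⟩ := (hPrm i p).1 hp
    have h1 := hdeg p ((hEm i p).1 hpE).1
    rw [← Finset.add_sum_erase _ _ (Finset.mem_univ i)] at h1
    have h2 : ∑ j ∈ Finset.univ.erase i, (Aux.dg χ VR j p : ℝ)
        ≤ ∑ _j ∈ Finset.univ.erase i, (1 : ℝ) := by
      apply Finset.sum_le_sum
      intro j hj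
      have : Aux.dg χ VR j p ≤ 1 := by
        by_contra hlt
        exact hpj j (Finset.ne_of_mem_erase hj)
          ((hEm j p).2 ⟨((hEm i p).1 hpE).1, by omega⟩)
      exact_mod_cast this
    rw [Finset.sum_const, Finset.card_erase_of_mem (Finset.mem_univ i), Finset.card_univ,
      Fintype.card_fin, nsmul_eq_mul, mul_one, Nat.cast_sub (by omega)] at h2
    push_cast at h2
    linarith
  obtain ⟨I, hI⟩ : ∃ I : Finset (Fin n), I = Finset.univ.filter (fun i => Rich n N χ i) :=
    ⟨_, rfl⟩
  have hcenter : ∀ i, ∃ a : Fin N, i ∈ I → ∀ p ∈ Pr i, a ∈ p := by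
    intro i
    by_cases hi : i ∈ I
    · have hrich : Rich n N χ i := by rw [hI] at hi; exact (Finset.mem_filter.1 hi).2
      unfold Rich realChoose2 at hrich
      rw [← hq] at hrich
      obtain ⟨a, ha⟩ := Aux.rich_center (colorClass χ i) (h3 i) (VR i) (VT i) (VS i)
        (hpart i).1 (hpart i).2.1 (hpart i).2.2.1 (hpart i).2.2.2 (hSstars i) (hR i) (hTcard i)
        ((N : ℝ) - n - 6 * q) ((n : ℝ) + 6 * q) (by linarith) (by linarith)
        (by rw [Fintype.card_fin]; ring) hrich
      refine ⟨a, fun _ p hp => ha p ?_ (hprdeg i p hp)⟩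
      exact hP2 p ((hQm p).1 ((hEm i p).1 ((hPrm i p).1 hp).1).1).1
    · exact ⟨Classical.arbitrary _, fun h => absurd h hi⟩
  choose a ha using hcenter
  have hIn : I.card ≤ n := by simpa using Finset.card_le_univ I
  have hIpr : ((∑ i ∈ I, (Pr i).card : ℕ) : ℝ)
      ≤ (I.card : ℝ) * N - I.card * (I.card + 1) / 2 := by
    rw [← Finset.card_biUnion]
    · have := Aux.pairs_meeting (I.image a) I.card Finset.card_image_le
        (by rw [Fintype.card_fin]; omega) (I.biUnion Pr) ?_ ?_
      · rw [Fintype.card_fin] at this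
        exact this
      · intro p hp
        obtain ⟨i, _, hp⟩ := Finset.mem_biUnion.1 hp
        exact hP2 p ((hQm p).1 ((hEm i p).1 ((hPrm i p).1 hp).1).1).1
      · intro p hp
        obtain ⟨i, hi, hp⟩ := Finset.mem_biUnion.1 hp
        exact ⟨a i, Finset.mem_image_of_mem a hi, ha i hi p hp⟩
    · intro i _ j _ hij
      rw [Function.onFun, Finset.disjoint_left]
      intro p hp hp'
      exact ((hPrm i p).1 hp).2 j hij.symm ((hPrm j p).1 hp').1
  have hIcpr : ((∑ i ∈ Iᶜ, (Pr i).card : ℕ) : ℝ) ≤ ((n : ℝ) - I.card) * N := by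
    have h1 : ∑ i ∈ Iᶜ, (Pr i).card ≤ ∑ _i ∈ Iᶜ, N := by
      apply Finset.sum_le_sum
      intro i _
      refine le_trans (Finset.card_le_card ?_) (hEcard i)
      intro p hp
      exact ((hPrm i p).1 hp).1
    rw [Finset.sum_const, Finset.card_compl, Fintype.card_fin, smul_eq_mul] at h1
    have h2 : ((∑ i ∈ Iᶜ, (Pr i).card : ℕ) : ℝ) ≤ (((n - I.card) * N : ℕ) : ℝ) := by
      exact_mod_cast h1
    rw [Nat.cast_mul, Nat.cast_sub hIn] at h2
    exact h2
  have hEsum : ((∑ i, (E i).card : ℕ) : ℝ) ≤ (n : ℝ) * N := by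
    have h1 : ∑ i, (E i).card ≤ ∑ _i : Fin n, N := Finset.sum_le_sum (fun i _ => hEcard i)
    rw [Finset.sum_const, Finset.card_univ, Fintype.card_fin, smul_eq_mul] at h1
    exact_mod_cast h1
  have hfinal : 2 * (Q.card : ℝ) ≤ ((∑ i, (E i).card : ℕ) : ℝ) +
      (((∑ i ∈ I, (Pr i).card : ℕ) : ℝ) + ((∑ i ∈ Iᶜ, (Pr i).card : ℕ) : ℝ)) := by
    rw [← Finset.sum_add_sum_compl I (fun i => (Pr i).card)] at hcount'
    exact_mod_cast hcount'
  have hPc : (P.card : ℝ) = realChoose2 N := by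
    rw [hP, Finset.card_powersetCard, Finset.card_univ, Fintype.card_fin, Aux.choose_two_real]
    rfl
  have hIeq : ((Finset.univ.filter (fun i : Fin n => Rich n N χ i)).card : ℝ) = I.card := by
    rw [hI]
  rw [hIeq, ← hPc]
  have hm0 : (0 : ℝ) ≤ I.card := Nat.cast_nonneg _
  have hqN : 3 * q * N ≤ 6 * (n * q) + 21 * n := by
    have : 3 * q * N ≤ 3 * q * (2 * n + 7 * q) := mul_le_mul_of_nonneg_left hN2 (by linarith)
    nlinarith
  nlinarith
end
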